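/- The critical diffusion sequence has the prefix property: given a reported profile t', a node i with non-nil reported type and critical diffusion sequence C*_i(t') = {s_1, s_2, …, s_k, …, i}, for any node j = s_k ∈ C*_i(t'), the critical diffusion sequence of j equals the initial segment of that of i, i.e., C*_j(t') = {s_1, s_2, …, s_k = j}. -/

import Mathlib

/-- A diffusion setting on a digraph: a seller `s`, the seller's
out-neighbours `rs`, and each node's true set of out-neighbours `r`. -/
structure DiffusionSetting (V : Type*) where
  s : V
  rs : Finset V
  r : V → Finset V

/-- A reported type profile: each node either reports a bid together with a
diffusion set, or has the `nil` type (`none`). -/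
abbrev Profile (V : Type*) := V → Option (ℝ × Finset V)

variable {V : Type*}

/-- The reported diffusion set of node `i` (empty if `nil`). -/
def rset (t' : Profile V) (i : V) : Finset V := ((t' i).map Prod.snd).getD ∅

namespace DiffusionSetting

variable (S : DiffusionSetting V)

/-- `L = (a₁, …, a_{l+1} = i)` is a trading path from the seller `s` to `i`:
`a₁ ∈ r_s` and each `a_j` belongs to the reported diffusion set of `a_{j-1}`. -/
def IsTradingPath (t' : Profile V) (i : V) (L : List V) : Prop :=
  L ≠ [] ∧ L.getLast? = some i ∧ (∀ a ∈ L.head?, a ∈ S.rs) ∧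
    L.Chain' (fun a b => b ∈ rset t' a)

/-- `i` has a non-`nil` reported type, i.e. it is reachable by a trading path. -/
def Informed (t' : Profile V) (i : V) : Prop := ∃ L, S.IsTradingPath t' i L

/-- `C_i(t')`: the critical diffusion nodes of `i`, the intersection of all
trading paths from the seller to `i`. -/
def critSet (t' : Profile V) (i : V) : Set V :=
  {j | ∀ L, S.IsTradingPath t' i L → j ∈ L}

/-- `L` is the critical diffusion sequence `C*_i(t')`: a duplicate-free
enumeration of `C_i(t')` ending in `i` in which each node is a critical
diffusion node of its successor. -/
def IsCritSeq (t' : Profile V) (i : V) (L : List V) : Prop :=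
  L.Nodup ∧ (∀ j, j ∈ L ↔ j ∈ S.critSet t' i) ∧ L.getLast? = some i ∧
    L.Chain' (fun a b => a ∈ S.critSet t' b)

end DiffusionSetting

namespace DiffusionSetting

variable {S : DiffusionSetting V} {t' : Profile V}

/-- Truncating a trading path at one of its nodes gives a trading path to that node. -/
theorem IsTradingPath.exists_prefix {c b : V} {L : List V}
    (hL : S.IsTradingPath t' c L) (hb : b ∈ L) :
    ∃ L', S.IsTradingPath t' b L' ∧ L' <+: L := by
  obtain ⟨-, -, hhead, hchain⟩ := hL
  obtain ⟨P, Q, rfl⟩ := List.append_of_mem hb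
  have hpre : P ++ [b] <+: P ++ b :: Q := ⟨Q, by simp⟩
  refine ⟨P ++ [b], ⟨by simp, by simp, ?_, hchain.prefix hpre⟩, hpre⟩
  cases P <;> simpa using hhead

theorem self_mem_critSet (i : V) : i ∈ S.critSet t' i :=
  fun _ hL => List.mem_of_getLast? hL.2.1

theorem critSet_trans {a b c : V} (hab : a ∈ S.critSet t' b) (hbc : b ∈ S.critSet t' c) :
    a ∈ S.critSet t' c := fun L hL =>
  let ⟨L', hL', hpre⟩ := hL.exists_prefix (hbc L hL)
  hpre.subset (hab L' hL')

theorem Informed.of_mem_critSet {i j : V} (hi : S.Informed t' i) (hj : j ∈ S.critSet t' i) :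
    S.Informed t' j :=
  let ⟨L, hL⟩ := hi
  let ⟨L', hL', _⟩ := hL.exists_prefix (hj L hL)
  ⟨L', hL'⟩

theorem critSet_antisymm {a b : V} (hb : S.Informed t' b)
    (hab : a ∈ S.critSet t' b) (hba : b ∈ S.critSet t' a) : a = b := by
  obtain ⟨L, hL, hmin⟩ := exists_minimalFor_of_wellFoundedLT
    (fun L => S.IsTradingPath t' b L) List.length hb
  obtain ⟨A, hA, hAL⟩ := hL.exists_prefix (hab L hL)
  obtain ⟨B, hB, hBA⟩ := hA.exists_prefix (hba A hA)
  have hlen : L.length ≤ A.length :=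
    (hmin hB (hBA.trans hAL).length_le).trans hBA.length_le
  obtain rfl := hAL.eq_of_length_le hlen
  exact Option.some.inj (hA.2.1.symm.trans hL.2.1)

theorem IsCritSeq.pairwise {i : V} {L : List V} (hL : S.IsCritSeq t' i L) :
    L.Pairwise (fun a b => a ∈ S.critSet t' b) :=
  have : IsTrans V (fun a b => a ∈ S.critSet t' b) := ⟨fun _ _ _ => critSet_trans⟩
  List.isChain_iff_pairwise.mp hL.2.2.2

end DiffusionSetting

/-- The critical diffusion sequence has the prefix property:
if `j ∈ C_i(t')` for a node `i` with non-nil reported type, then the critical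
diffusion sequence of `j` is exactly the initial segment of that of `i`
ending at `j`. -/
theorem critical_sequence_prefix
    {V : Type*} (S : DiffusionSetting V)
    (t' : Profile V) (i : V) (hi : S.Informed t' i)
    (Li : List V) (hLi : S.IsCritSeq t' i Li)
    (j : V) (hj : j ∈ S.critSet t' i)
    (Lj : List V) (hLj : S.IsCritSeq t' j Lj) :
    Lj <+: Li := by
  have hpair := hLi.pairwise
  obtain ⟨hnodup, hmem, -, -⟩ := hLi
  obtain ⟨P, Q, rfl⟩ := List.append_of_mem ((hmem j).2 hj)
  have hpre : P ++ [j] <+: P ++ j :: Q := ⟨Q, by simp⟩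
  have hinf : S.Informed t' j := hi.of_mem_critSet hj
  have hset : ∀ x, x ∈ P ++ [j] ↔ x ∈ S.critSet t' j := by
    intro x
    rw [List.pairwise_append, List.pairwise_cons] at hpair
    constructor
    · intro hx
      rcases List.mem_append.1 hx with hx | hx
      · exact hpair.2.2 x hx j (by simp)
      · rw [List.mem_singleton.1 hx]
        exact DiffusionSetting.self_mem_critSet j
    · intro hx
      have hxi := (hmem x).2 (DiffusionSetting.critSet_trans hx hj)
      rcases List.mem_append.1 hxi with h | h
      · simp [h]
      rcases List.mem_cons.1 h with h | h
      · simp [h]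
      · simp [DiffusionSetting.critSet_antisymm hinf hx (hpair.2.1.1 x h)]
  have hperm : Lj.Perm (P ++ [j]) :=
    (List.perm_ext_iff_of_nodup hLj.1 (hnodup.sublist hpre.sublist)).2
      fun x => (hLj.2.1 x).trans (hset x).symm
  have heq : Lj = P ++ [j] :=
    hperm.eq_of_pairwise
      (fun a b _ hb hab hba => DiffusionSetting.critSet_antisymm
        (hinf.of_mem_critSet ((hset b).1 hb)) hab hba)
      hLj.pairwise (hpair.sublist hpre.sublist)
  exact heq ▸ hpre
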